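/- Let {P(u,·), u ∈ X} be a generalised Markov kernel on a compact metric space (X,d) and A ⊂ X a closed set with P(u, X∖A) = 0 for u ∈ A, satisfying conditions (i)-(iv) with eigenvalue λ = 1; let μ be a Borel probability measure with supp μ = A and 𝔓_1^* μ = μ, and h : X → (0,∞) Lipschitz-continuous with 𝔓_1 h = h and ⟨h, μ⟩ = 1. Define the Markov semigroup 𝒮_k g = h^{−1} 𝔓_k(gh) on C(X), with dual 𝒮_k^* acting on probability measures by ⟨g, 𝒮_k^* σ⟩ = ⟨𝒮_k g, σ⟩. Then the probability measure σ̂ with density h with respect to μ is the unique stationary measure of 𝒮_k, and there exist numbers C > 0 and γ > 0 such that ‖𝒮_k^* σ − σ̂‖_L^* ≤ C e^{−γ k} for every Borel probability measure σ on X and every k ≥ 1. -/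

import Mathlib

open MeasureTheory Filter Set Metric

noncomputable section

namespace GMK

variable {X : Type} [MetricSpace X] [CompactSpace X] [MeasurableSpace X] [BorelSpace X]

/-- Iterations `P_k(u, ·)` of a (generalised Markov) kernel, with `P_0(u,·) = δ_u`. -/
def iterP (P : X → Measure X) : ℕ → X → Measure X
  | 0 => fun u => Measure.dirac u
  | (n+1) => fun u => (iterP P n u).bind P

/-- The semigroup `𝔓_k f (u) = ∫ f(v) P_k(u, dv)`. -/
def PP (P : X → Measure X) (k : ℕ) (f : X → ℝ) (u : X) : ℝ := ∫ v, f v ∂(iterP P k u)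

/-- The dual semigroup `𝔓_k^* μ (Γ) = ∫ P_k(u, Γ) μ(du)`. -/
def PPstar (P : X → Measure X) (k : ℕ) (μ : Measure X) : Measure X := μ.bind (iterP P k)

/-- Support of a Borel measure. -/
def msupp (μ : Measure X) : Set X := {x | ∀ U : Set X, IsOpen U → x ∈ U → 0 < μ U}

/-- `‖f‖_X`, the sup-norm over `X`. -/
def supX (f : X → ℝ) : ℝ := sSup (Set.range fun u => |f u|)

/-- `f : X → ℝ` is Lipschitz. -/
def IsLip (f : X → ℝ) : Prop := ∃ L : ℝ, ∀ u v, |f u - f v| ≤ L * dist u v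

/-- The Lipschitz norm `‖f‖_L = ‖f‖_∞ + Lip(f)`. -/
def lipNorm (f : X → ℝ) : ℝ :=
  supX f + sInf {L | 0 ≤ L ∧ ∀ u v, |f u - f v| ≤ L * dist u v}

/-- A generalised Markov kernel: finite nonvanishing measures depending continuously
(in the weak topology) and measurably on the point. -/
def GenKernel (P : X → Measure X) : Prop :=
  (∀ u, IsFiniteMeasure (P u)) ∧ (∀ u, P u Set.univ ≠ 0) ∧
  (∀ Γ : Set X, MeasurableSet Γ → Measurable fun u => P u Γ) ∧
  (∀ f : X → ℝ, Continuous f → Continuous fun u => ∫ v, f v ∂(P u))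

/-- (i) Refined uniform Feller property. -/
def CondI (P : X → Measure X) : Prop :=
  ∀ c : ℝ, 0 < c → c < 1 → ∃ C : ℝ, 0 < C ∧
    ∀ k : ℕ, 1 ≤ k → ∀ f : X → ℝ, IsLip f → ∀ v v' : X,
      |PP P k f v - PP P k f v'| ≤
        (C * supX f + c * lipNorm f) * supX (PP P k fun _ => 1) * dist v v'

/-- (ii) Uniform irreducibility on `A`. -/
def CondII (P : X → Measure X) (A : Set X) : Prop :=
  ∀ r : ℝ, 0 < r → ∃ m : ℕ, 1 ≤ m ∧ ∃ p : ℝ, 0 < p ∧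
    ∀ u : X, ∀ uhat ∈ A, ENNReal.ofReal p ≤ iterP P m u (closedBall uhat r)

/-- (iii) Concentration near `A`:  `sup_u P_k(u, X ∖ A_r) → 0`. -/
def CondIII (P : X → Measure X) (A : Set X) : Prop :=
  ∀ r : ℝ, 0 < r → ∀ ε : ℝ, 0 < ε → ∃ N : ℕ, ∀ k ≥ N, ∀ u : X,
    iterP P k u {x | ¬ Metric.infDist x A < r} ≤ ENNReal.ofReal ε

/-- (iv) Exponential bound `sup_k λ^{-k} ‖𝔓_k 1‖_X < ∞`. -/
def CondIV (P : X → Measure X) (lam : ℝ) : Prop :=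
  ∃ Λ : ℝ, ∀ k : ℕ, 1 ≤ k → lam ^ (-(k : ℤ)) * supX (PP P k fun _ => 1) ≤ Λ

/-- The dual `𝒮_k^*` of the auxiliary Markov semigroup `𝒮_k g = h⁻¹ 𝔓_k (g h)`. -/
def SStar (P : X → Measure X) (h : X → ℝ) (k : ℕ) (σ : Measure X) : Measure X :=
  ((σ.withDensity fun u => ENNReal.ofReal (h u)⁻¹).bind (iterP P k)).withDensity
    fun u => ENNReal.ofReal (h u)

omit [MetricSpace X] [CompactSpace X] [BorelSpace X] in
theorem integral_bind_eq {κ : X → Measure X} (hκ : Measurable κ) {ν : Measure X} {f : X → ℝ}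
    (hf : Integrable f (ν.bind κ)) : ∫ v, f v ∂(ν.bind κ) = ∫ u, ∫ v, f v ∂(κ u) ∂ν := by
  let K : ProbabilityTheory.Kernel X X := ⟨κ, hκ⟩
  change Integrable f (ν.bind K) at hf
  change ∫ v, f v ∂(ν.bind K) = ∫ u, ∫ v, f v ∂(K u) ∂ν
  rw [Measure.comp_eq_comp_const_apply] at hf ⊢
  rw [ProbabilityTheory.Kernel.integral_comp hf]
  simp

theorem integrable_of_continuous {f : X → ℝ} (hf : Continuous f) (ν : Measure X)
    [IsFiniteMeasure ν] : Integrable f ν :=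
  hf.integrable_of_hasCompactSupport (HasCompactSupport.of_compactSpace f)

omit [CompactSpace X] [MeasurableSpace X] [BorelSpace X] in
theorem IsLip.continuous {f : X → ℝ} (hf : IsLip f) : Continuous f := by
  obtain ⟨L, hL⟩ := hf
  refine (LipschitzWith.of_dist_le_mul (K := L.toNNReal) fun u v => ?_).continuous
  rw [Real.dist_eq]
  exact (hL u v).trans (mul_le_mul_of_nonneg_right (Real.le_coe_toNNReal L) dist_nonneg)

omit [MeasurableSpace X] [BorelSpace X] in
theorem abs_le_supX {f : X → ℝ} (hf : Continuous f) (u : X) : |f u| ≤ supX f :=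
  le_csSup (isCompact_range hf.abs).bddAbove ⟨u, rfl⟩

omit [MetricSpace X] [CompactSpace X] [MeasurableSpace X] [BorelSpace X] in
theorem supX_le [Nonempty X] {f : X → ℝ} {a : ℝ} (hf : ∀ u, |f u| ≤ a) : supX f ≤ a :=
  csSup_le (range_nonempty _) (by rintro _ ⟨u, rfl⟩; exact hf u)

omit [CompactSpace X] [MeasurableSpace X] [BorelSpace X] in
theorem lipNorm_le [Nonempty X] {f : X → ℝ} {a L : ℝ} (hf : ∀ u, |f u| ≤ a) (hL : 0 ≤ L)
    (hfL : ∀ u v, |f u - f v| ≤ L * dist u v) : lipNorm f ≤ a + L :=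
  add_le_add (supX_le hf) (csInf_le ⟨0, fun _ h => h.1⟩ ⟨hL, hfL⟩)

omit [MeasurableSpace X] [BorelSpace X] in
theorem bounds_of_lipNorm_le_one {f : X → ℝ} (hf : IsLip f) (h1 : lipNorm f ≤ 1) :
    (∀ u v, f u - f v ≤ 2) ∧ ∀ u v, |f u - f v| ≤ 2 * dist u v := by
  have hsup : 0 ≤ supX f := Real.sSup_nonneg (by rintro _ ⟨u, rfl⟩; exact abs_nonneg _)
  have hinf : 0 ≤ sInf {L | 0 ≤ L ∧ ∀ u v, |f u - f v| ≤ L * dist u v} :=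
    Real.sInf_nonneg fun _ h => h.1
  have hne : {L | 0 ≤ L ∧ ∀ u v, |f u - f v| ≤ L * dist u v}.Nonempty := by
    obtain ⟨L, hL⟩ := hf
    exact ⟨max L 0, le_max_right _ _, fun u v => (hL u v).trans
      (mul_le_mul_of_nonneg_right (le_max_left _ _) dist_nonneg)⟩
  unfold lipNorm at h1
  constructor
  · intro u v
    have hu := abs_le.1 (abs_le_supX hf.continuous u)
    have hv := abs_le.1 (abs_le_supX hf.continuous v)
    linarith [hu.2, hv.1]
  · obtain ⟨L, hL, hL2⟩ := exists_lt_of_csInf_lt (b := 2) hne (by linarith)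
    exact fun u v => (hL.2 u v).trans (mul_le_mul_of_nonneg_right hL2.le dist_nonneg)

omit [MeasurableSpace X] [BorelSpace X] in
theorem exists_pos_bounds [Nonempty X] {h : X → ℝ} (hc : Continuous h) (hpos : ∀ u, 0 < h u) :
    ∃ c₀ c₁ : ℝ, 0 < c₀ ∧ 0 < c₁ ∧ ∀ u, c₀ ≤ h u ∧ h u ≤ c₁ := by
  obtain ⟨x, hx⟩ := hc.exists_forall_le_of_hasCompactSupport (HasCompactSupport.of_compactSpace h)
  obtain ⟨y, hy⟩ := hc.exists_forall_ge_of_hasCompactSupport (HasCompactSupport.of_compactSpace h)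
  exact ⟨h x, h y, hpos x, hpos y, fun u => ⟨hx u, hy u⟩⟩

theorem abs_integral_sub_integral_le {g : X → ℝ} (hg : Continuous g) {a : ℝ}
    (ha : ∀ u v, g u - g v ≤ a) (σ τ : Measure X) [IsProbabilityMeasure σ]
    [IsProbabilityMeasure τ] : |∫ v, g v ∂σ - ∫ v, g v ∂τ| ≤ a := by
  have key : ∀ (σ τ : Measure X) [IsProbabilityMeasure σ] [IsProbabilityMeasure τ],
      ∫ v, g v ∂σ - ∫ v, g v ∂τ ≤ a := by
    intro σ τ _ _
    have h1 : ∀ v, ∫ u, g u ∂σ ≤ a + g v := fun v => by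
      have := integral_mono (integrable_of_continuous hg σ) (integrable_const (a + g v))
        fun u => by linarith [ha u v]
      simpa using this
    have h2 := integral_mono (integrable_const (∫ u, g u ∂σ))
      ((integrable_const a).add (integrable_of_continuous hg τ)) h1
    simp only [Pi.add_apply] at h2
    rw [integral_add (integrable_const a) (integrable_of_continuous hg τ)] at h2
    simp only [integral_const, probReal_univ, one_smul] at h2
    linarith
  rw [abs_le]
  constructor <;> linarith [key σ τ, key τ σ]

omit [BorelSpace X] in
theorem msupp_nonempty (μ : Measure X) [NeZero μ] : (msupp μ).Nonempty := by
  by_contra hne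
  rw [not_nonempty_iff_eq_empty] at hne
  refine NeZero.ne μ (Measure.measure_univ_eq_zero.1 (measure_null_of_locally_null _ fun x _ => ?_))
  have hx : x ∉ msupp μ := by simp [hne]
  simp only [msupp, mem_ofPred_eq, not_forall, not_lt, nonpos_iff_eq_zero] at hx
  obtain ⟨U, hU, hxU, h0⟩ := hx
  exact ⟨U, mem_nhdsWithin_of_mem_nhds (hU.mem_nhds hxU), h0⟩

omit [CompactSpace X] [BorelSpace X] in
theorem GenKernel.measurable {P : X → Measure X} (hP : GenKernel P) : Measurable P :=
  Measure.measurable_of_measurable_coe _ hP.2.2.1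

omit [BorelSpace X] in
theorem GenKernel.exists_mass_le {P : X → Measure X} (hP : GenKernel P) :
    ∃ M : NNReal, ∀ u, P u univ ≤ M := by
  have hc : Continuous fun u => (P u).real univ := by
    simpa using hP.2.2.2 (fun _ => 1) continuous_const
  obtain ⟨M, hM⟩ := (isCompact_range hc).bddAbove
  refine ⟨M.toNNReal, fun u => ?_⟩
  have := hP.1 u
  rw [← ENNReal.ofReal_toReal (measure_ne_top (P u) univ)]
  exact ENNReal.ofReal_le_ofReal (hM ⟨u, rfl⟩)

omit [BorelSpace X] in
theorem GenKernel.isFiniteMeasure_bind {P : X → Measure X} (hP : GenKernel P) (ν : Measure X)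
    [IsFiniteMeasure ν] : IsFiniteMeasure (ν.bind P) := by
  obtain ⟨M, hM⟩ := hP.exists_mass_le
  constructor
  rw [Measure.bind_apply MeasurableSet.univ hP.measurable.aemeasurable]
  refine (lintegral_mono hM).trans_lt ?_
  rw [lintegral_const]
  exact ENNReal.mul_lt_top ENNReal.coe_lt_top (measure_lt_top _ _)

omit [BorelSpace X] in
theorem GenKernel.isFiniteMeasure_iterP {P : X → Measure X} (hP : GenKernel P) (n : ℕ) (u : X) :
    IsFiniteMeasure (iterP P n u) := by
  induction n with
  | zero => exact inferInstanceAs (IsFiniteMeasure (Measure.dirac u))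
  | succ n ih => exact hP.isFiniteMeasure_bind _

omit [CompactSpace X] [BorelSpace X] in
theorem GenKernel.measurable_iterP {P : X → Measure X} (hP : GenKernel P) (n : ℕ) :
    Measurable (iterP P n) := by
  induction n with
  | zero => exact Measure.measurable_dirac
  | succ n ih => exact (Measure.measurable_bind' hP.measurable).comp ih

omit [CompactSpace X] [BorelSpace X] in
theorem GenKernel.bind_iterP_succ {P : X → Measure X} (hP : GenKernel P) (n : ℕ)
    (ν : Measure X) : ν.bind (iterP P (n + 1)) = (ν.bind (iterP P n)).bind P :=
  (Measure.bind_bind (hP.measurable_iterP n).aemeasurable hP.measurable.aemeasurable).symm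

omit [BorelSpace X] in
theorem GenKernel.isFiniteMeasure_bind_iterP {P : X → Measure X} (hP : GenKernel P) (n : ℕ)
    (ν : Measure X) [IsFiniteMeasure ν] : IsFiniteMeasure (ν.bind (iterP P n)) := by
  induction n with
  | zero =>
    change IsFiniteMeasure (ν.bind Measure.dirac)
    rwa [Measure.bind_dirac]
  | succ n ih =>
    rw [hP.bind_iterP_succ]
    exact hP.isFiniteMeasure_bind _

omit [CompactSpace X] [BorelSpace X] in
theorem GenKernel.PP_one {P : X → Measure X} (hP : GenKernel P) (g : X → ℝ) (u : X) :
    PP P 1 g u = ∫ v, g v ∂(P u) := by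
  simp [PP, iterP, Measure.dirac_bind hP.measurable]

omit [CompactSpace X] [BorelSpace X] in
theorem GenKernel.continuous_PP_one {P : X → Measure X} (hP : GenKernel P) {g : X → ℝ}
    (hg : Continuous g) : Continuous (PP P 1 g) := by
  simpa only [funext (hP.PP_one g)] using hP.2.2.2 g hg

theorem GenKernel.PP_succ {P : X → Measure X} (hP : GenKernel P) (n : ℕ) {g : X → ℝ}
    (hg : Continuous g) : PP P (n + 1) g = PP P n (PP P 1 g) := by
  funext u
  have := hP.isFiniteMeasure_iterP n u
  have := hP.isFiniteMeasure_bind (iterP P n u)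
  rw [funext (hP.PP_one g)]
  exact integral_bind_eq hP.measurable (integrable_of_continuous hg _)

theorem PP_zero (P : X → Measure X) (g : X → ℝ) : PP P 0 g = g := by
  funext u
  simp [PP, iterP]

theorem GenKernel.continuous_PP {P : X → Measure X} (hP : GenKernel P) (n : ℕ) {g : X → ℝ}
    (hg : Continuous g) : Continuous (PP P n g) := by
  induction n generalizing g with
  | zero => rwa [PP_zero]
  | succ n ih => rw [hP.PP_succ n hg]; exact ih (hP.continuous_PP_one hg)

theorem GenKernel.PP_eigenfunction {P : X → Measure X} (hP : GenKernel P) {h : X → ℝ}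
    (hc : Continuous h) (heig : ∀ u, PP P 1 h u = h u) (n : ℕ) : PP P n h = h := by
  induction n with
  | zero => exact PP_zero P h
  | succ n ih => rw [hP.PP_succ n hc, funext heig, ih]

/-- The auxiliary Markov semigroup `𝒮_k f = h⁻¹ 𝔓_k (f h)`. -/
def doob (P : X → Measure X) (h : X → ℝ) (k : ℕ) (f : X → ℝ) (u : X) : ℝ :=
  (h u)⁻¹ * PP P k (fun v => f v * h v) u

section Doob

variable {P : X → Measure X} {h : X → ℝ}

omit [MetricSpace X] [CompactSpace X] [BorelSpace X] in
theorem mul_doob (hpos : ∀ u, 0 < h u) (k : ℕ) (f : X → ℝ) (u : X) :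
    h u * doob P h k f u = PP P k (fun v => f v * h v) u :=
  mul_inv_cancel_left₀ (hpos u).ne' _

theorem continuous_doob (hP : GenKernel P) (hc : Continuous h) (hpos : ∀ u, 0 < h u) (k : ℕ)
    {f : X → ℝ} (hf : Continuous f) : Continuous (doob P h k f) :=
  (hc.inv₀ fun u => (hpos u).ne').mul (hP.continuous_PP k (hf.fun_mul hc))

theorem doob_zero (hpos : ∀ u, 0 < h u) (f : X → ℝ) : doob P h 0 f = f := by
  funext u
  have := (hpos u).ne'
  simp only [doob, PP_zero]
  field_simp

theorem doob_succ (hP : GenKernel P) (hc : Continuous h) (hpos : ∀ u, 0 < h u) (k : ℕ)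
    {f : X → ℝ} (hf : Continuous f) : doob P h (k + 1) f = doob P h k (doob P h 1 f) := by
  funext u
  have : (fun v => doob P h 1 f v * h v) = PP P 1 fun v => f v * h v := by
    funext v
    rw [mul_comm, mul_doob hpos]
  rw [doob, doob, this, hP.PP_succ k (hf.fun_mul hc)]

theorem doob_add (hP : GenKernel P) (hc : Continuous h) (hpos : ∀ u, 0 < h u) (j k : ℕ)
    {f : X → ℝ} (hf : Continuous f) : doob P h (j + k) f = doob P h j (doob P h k f) := by
  induction k generalizing f with
  | zero => rw [doob_zero hpos]; rfl
  | succ k ih =>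
    rw [← add_assoc, doob_succ hP hc hpos _ hf, ih (continuous_doob hP hc hpos 1 hf),
      ← doob_succ hP hc hpos _ hf]

theorem doob_const (hP : GenKernel P) (hc : Continuous h) (hpos : ∀ u, 0 < h u)
    (heig : ∀ u, PP P 1 h u = h u) (k : ℕ) (c : ℝ) (u : X) :
    doob P h k (fun _ => c) u = c := by
  have := congrFun (hP.PP_eigenfunction hc heig k) u
  simp only [PP] at this
  have := (hpos u).ne'
  simp only [doob, PP, integral_const_mul, *]
  field_simp

theorem doob_sub (hP : GenKernel P) (hc : Continuous h) (k : ℕ)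
    {f g : X → ℝ} (hf : Continuous f) (hg : Continuous g) (u : X) :
    doob P h k (fun v => f v - g v) u = doob P h k f u - doob P h k g u := by
  have := hP.isFiniteMeasure_iterP k u
  simp only [doob, PP, sub_mul]
  rw [integral_sub (integrable_of_continuous (hf.fun_mul hc) _)
    (integrable_of_continuous (hg.fun_mul hc) _), mul_sub]

omit [MetricSpace X] [CompactSpace X] [BorelSpace X] in
theorem doob_nonneg (hpos : ∀ u, 0 < h u) (k : ℕ) {g : X → ℝ} (hg : ∀ v, 0 ≤ g v) (u : X) :
    0 ≤ doob P h k g u :=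
  mul_nonneg (inv_nonneg.2 (hpos u).le)
    (integral_nonneg fun v => mul_nonneg (hg v) (hpos v).le)

theorem doob_sub_const (hP : GenKernel P) (hc : Continuous h) (hpos : ∀ u, 0 < h u)
    (heig : ∀ u, PP P 1 h u = h u) (k : ℕ) {f : X → ℝ} (hf : Continuous f) (c : ℝ) (u : X) :
    doob P h k (fun v => f v - c) u = doob P h k f u - c := by
  rw [doob_sub hP hc k hf continuous_const, doob_const hP hc hpos heig]

theorem doob_const_sub (hP : GenKernel P) (hc : Continuous h) (hpos : ∀ u, 0 < h u)
    (heig : ∀ u, PP P 1 h u = h u) (k : ℕ) {f : X → ℝ} (hf : Continuous f) (c : ℝ) (u : X) :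
    doob P h k (fun v => c - f v) u = c - doob P h k f u := by
  rw [doob_sub hP hc k continuous_const hf, doob_const hP hc hpos heig]

theorem doob_sub_le (hP : GenKernel P) (hc : Continuous h) (hpos : ∀ u, 0 < h u)
    (heig : ∀ u, PP P 1 h u = h u) (k : ℕ) {f : X → ℝ} (hf : Continuous f) {a : ℝ}
    (ha : ∀ u v, f u - f v ≤ a) (u v : X) : doob P h k f u - doob P h k f v ≤ a := by
  have h1 : ∀ w, f w ≤ doob P h k f v + a := fun w => by
    have := doob_nonneg (P := P) hpos k (g := fun x => f x - (f w - a))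
      (fun x => by linarith [ha w x]) v
    rw [doob_sub_const hP hc hpos heig k hf] at this
    linarith
  have := doob_nonneg (P := P) hpos k (g := fun x => (doob P h k f v + a) - f x)
    (fun x => by linarith [h1 x]) u
  rw [doob_const_sub hP hc hpos heig k hf] at this
  linarith

theorem le_doob_of_le_on (hP : GenKernel P) (hc : Continuous h) (hpos : ∀ u, 0 < h u)
    {c₀ c₁ : ℝ} (hc₀ : 0 < c₀) (hb : ∀ u, c₀ ≤ h u ∧ h u ≤ c₁) (k : ℕ) {g : X → ℝ}
    (hg : Continuous g) (hg0 : ∀ v, 0 ≤ g v) {B : Set X} (hB : MeasurableSet B) {s : ℝ}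
    (hs : ∀ v ∈ B, s ≤ g v) {p : ℝ} (hp : 0 < p) {u : X}
    (hpB : ENNReal.ofReal p ≤ iterP P k u B) : p * c₀ / c₁ * s ≤ doob P h k g u := by
  have hc₁ : 0 < c₁ := hc₀.trans_le ((hb u).1.trans (hb u).2)
  rcases le_total s 0 with hs0 | hs0
  · exact (mul_nonpos_of_nonneg_of_nonpos (by positivity) hs0).trans (doob_nonneg hpos k hg0 u)
  have := hP.isFiniteMeasure_iterP k u
  have hint := integrable_of_continuous (hg.fun_mul hc) (iterP P k u)
  have h1 : (iterP P k u).real B * (s * c₀) ≤ ∫ v in B, g v * h v ∂(iterP P k u) := by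
    have := setIntegral_mono_on (μ := iterP P k u) (integrable_const (s * c₀)).integrableOn
      hint.integrableOn hB
      fun v hv => mul_le_mul (hs v hv) (hb v).1 hc₀.le (hg0 v)
    simpa using this
  have h2 : ∫ v in B, g v * h v ∂(iterP P k u) ≤ ∫ v, g v * h v ∂(iterP P k u) :=
    setIntegral_le_integral hint (.of_forall fun v => mul_nonneg (hg0 v) (hpos v).le)
  have h3 : p ≤ (iterP P k u).real B :=
    (ENNReal.ofReal_le_iff_le_toReal (measure_ne_top _ _)).1 hpB
  have h4 : p * (s * c₀) ≤ ∫ v, g v * h v ∂(iterP P k u) :=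
    (mul_le_mul_of_nonneg_right h3 (by positivity)).trans (h1.trans h2)
  have h5 : c₁⁻¹ ≤ (h u)⁻¹ := inv_anti₀ (hpos u) (hb u).2
  calc p * c₀ / c₁ * s = c₁⁻¹ * (p * (s * c₀)) := by ring
    _ ≤ (h u)⁻¹ * ∫ v, g v * h v ∂(iterP P k u) :=
      mul_le_mul h5 h4 (by positivity) (inv_nonneg.2 (hpos u).le)

theorem doob_lipschitz_le [Nonempty X] (hP : GenKernel P) (hi : CondI P) (hiv : CondIV P 1)
    (hlip : IsLip h) (hpos : ∀ u, 0 < h u) (heig : ∀ u, PP P 1 h u = h u) :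
    ∃ C : ℝ, 0 < C ∧ ∀ k : ℕ, 1 ≤ k → ∀ (f : X → ℝ) (a L : ℝ), 0 ≤ L →
      (∀ u v, f u - f v ≤ a) → (∀ u v, |f u - f v| ≤ L * dist u v) →
      ∀ u v, |doob P h k f u - doob P h k f v| ≤ (C * a + 1 / 2 * L) * dist u v := by
  have hc := hlip.continuous
  obtain ⟨c₀, c₁, hc₀, hc₁, hb⟩ := exists_pos_bounds hc hpos
  obtain ⟨H, hH0, hH⟩ : ∃ H : ℝ, 0 ≤ H ∧ ∀ u v, |h u - h v| ≤ H * dist u v := by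
    obtain ⟨H, hH⟩ := hlip
    exact ⟨max H 0, le_max_right _ _, fun u v => (hH u v).trans
      (mul_le_mul_of_nonneg_right (le_max_left _ _) dist_nonneg)⟩
  obtain ⟨K, hK0, hK⟩ : ∃ K : ℝ, 0 < K ∧ ∀ k : ℕ, 1 ≤ k → supX (PP P k fun _ => 1) ≤ K := by
    obtain ⟨K, hK⟩ := hiv
    refine ⟨max K 1, lt_max_of_lt_right one_pos, fun k hk => le_max_of_le_left ?_⟩
    simpa using hK k hk
  obtain ⟨c, hcpos, hc1, hcK⟩ : ∃ c : ℝ, 0 < c ∧ c < 1 ∧ c * c₁ * K ≤ c₀ / 2 := by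
    refine ⟨min (1 / 2) (c₀ / (2 * K * c₁)), by positivity,
      (min_le_left _ _).trans_lt (by norm_num), ?_⟩
    calc min (1 / 2) (c₀ / (2 * K * c₁)) * c₁ * K ≤ c₀ / (2 * K * c₁) * c₁ * K := by
          gcongr
          exact min_le_right _ _
      _ = c₀ / 2 := by field_simp
  obtain ⟨C, hC, hCI⟩ := hi c hcpos hc1
  refine ⟨(C * c₁ * K + c * K * (c₁ + H) + H) / c₀, by positivity, ?_⟩
  intro k hk f a L hL ha hfL u v
  have hf : Continuous f := IsLip.continuous ⟨L, hfL⟩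
  have ha0 : 0 ≤ a := by simpa using ha u u
  set G : X → ℝ := fun w => (f w - f v) * h w with hG
  have hg : ∀ w, |f w - f v| ≤ a := fun w => abs_le.2 ⟨by linarith [ha v w], ha w v⟩
  have hGa : ∀ w, |G w| ≤ a * c₁ := fun w => by
    rw [hG, abs_mul, abs_of_pos (hpos w)]
    exact mul_le_mul (hg w) (hb w).2 (hpos w).le ha0
  have hGL : ∀ x y, |G x - G y| ≤ (a * H + c₁ * L) * dist x y := fun x y => by
    have : G x - G y = (f x - f v) * (h x - h y) + h y * (f x - f y) := by simp only [hG]; ring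
    rw [this]
    refine (abs_add_le _ _).trans ?_
    rw [abs_mul, abs_mul, abs_of_pos (hpos y), add_mul, mul_assoc, mul_assoc]
    exact add_le_add (mul_le_mul (hg x) (hH x y) (abs_nonneg _) ha0)
      (mul_le_mul (hb y).2 (hfL x y) (abs_nonneg _) hc₁.le)
  have hLn : lipNorm G ≤ a * c₁ + (a * H + c₁ * L) := lipNorm_le hGa (by positivity) hGL
  have hsn : supX G ≤ a * c₁ := supX_le hGa
  set d := dist u v with hd
  have hd0 : 0 ≤ d := dist_nonneg
  have hPP : |PP P k G u - PP P k G v| ≤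
      (C * (a * c₁) + c * (a * c₁ + (a * H + c₁ * L))) * K * d := by
    have hK' := hK k hk
    have hsup : 0 ≤ supX (PP P k fun _ => 1) :=
      Real.sSup_nonneg (by rintro _ ⟨u, rfl⟩; exact abs_nonneg _)
    refine (hCI k hk G ⟨_, hGL⟩ u v).trans ?_
    gcongr
  have hDG : ∀ w, h w * (doob P h k f w - f v) = PP P k G w := fun w => by
    rw [← doob_sub_const hP hc hpos heig k hf, mul_doob hpos]
  have hDv : |doob P h k f v - f v| ≤ a := by
    rw [abs_le]
    have h1 := doob_nonneg (P := P) hpos k (g := fun x => f x - (f v - a))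
      (fun x => by linarith [ha v x]) v
    have h2 := doob_nonneg (P := P) hpos k (g := fun x => (f v + a) - f x)
      (fun x => by linarith [ha x v]) v
    rw [doob_sub_const hP hc hpos heig k hf] at h1
    rw [doob_const_sub hP hc hpos heig k hf] at h2
    constructor <;> linarith
  have hid : h u * (doob P h k f u - doob P h k f v) =
      (PP P k G u - PP P k G v) - (doob P h k f v - f v) * (h u - h v) := by
    rw [← hDG, ← hDG]; ring
  have hmain : c₀ * |doob P h k f u - doob P h k f v| ≤
      (C * (a * c₁) + c * (a * c₁ + (a * H + c₁ * L))) * K * d + a * (H * d) := by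
    calc c₀ * |doob P h k f u - doob P h k f v|
        ≤ h u * |doob P h k f u - doob P h k f v| :=
          mul_le_mul_of_nonneg_right (hb u).1 (abs_nonneg _)
      _ = |h u * (doob P h k f u - doob P h k f v)| := by rw [abs_mul, abs_of_pos (hpos u)]
      _ ≤ |PP P k G u - PP P k G v| + |(doob P h k f v - f v) * (h u - h v)| := by
          rw [hid]; exact abs_sub _ _
      _ ≤ _ := by
          refine add_le_add hPP ?_
          rw [abs_mul]
          exact mul_le_mul hDv (hH u v) (abs_nonneg _) ha0
  have hcL : c * c₁ * K * (L * d) ≤ c₀ / 2 * (L * d) :=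
    mul_le_mul_of_nonneg_right hcK (by positivity)
  have hexp : c₀ * (((C * c₁ * K + c * K * (c₁ + H) + H) / c₀ * a + 1 / 2 * L) * d) =
      (C * c₁ * K + c * K * (c₁ + H) + H) * a * d + c₀ / 2 * (L * d) := by
    field_simp
  refine le_of_mul_le_mul_left ?_ hc₀
  rw [hexp]
  linarith

theorem doob_oscillation_le [Nonempty X] (hP : GenKernel P) (hc : Continuous h)
    (hpos : ∀ u, 0 < h u) (heig : ∀ u, PP P 1 h u = h u)
    {c₀ c₁ : ℝ} (hc₀ : 0 < c₀) (hb : ∀ u, c₀ ≤ h u ∧ h u ≤ c₁)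
    {m : ℕ} {x : X} {r p : ℝ} (hp : 0 < p)
    (hball : ∀ u, ENNReal.ofReal p ≤ iterP P m u (closedBall x r))
    {f : X → ℝ} {a L : ℝ} (hL : 0 ≤ L) (ha : ∀ u v, f u - f v ≤ a)
    (hfL : ∀ u v, |f u - f v| ≤ L * dist u v) (u v : X) :
    doob P h m f u - doob P h m f v ≤
      (1 - p * c₀ / c₁) * a + 2 * r * (p * c₀ / c₁) * L := by
  have hf : Continuous f := IsLip.continuous ⟨L, hfL⟩
  have hball' : ∀ w ∈ closedBall x r, |f w - f x| ≤ L * r := fun w hw =>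
    (hfL w x).trans (mul_le_mul_of_nonneg_left hw hL)
  obtain ⟨y, hy⟩ := hf.exists_forall_le_of_hasCompactSupport (HasCompactSupport.of_compactSpace f)
  obtain ⟨z, hz⟩ := hf.exists_forall_ge_of_hasCompactSupport (HasCompactSupport.of_compactSpace f)
  have h1 := le_doob_of_le_on hP hc hpos hc₀ hb m (g := fun w => f z - f w) (by fun_prop)
    (fun w => sub_nonneg.2 (hz w)) measurableSet_closedBall (s := f z - f x - L * r)
    (fun w hw => by linarith [(abs_le.1 (hball' w hw)).2]) hp (hball u)
  have h2 := le_doob_of_le_on hP hc hpos hc₀ hb m (g := fun w => f w - f y) (by fun_prop)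
    (fun w => sub_nonneg.2 (hy w)) measurableSet_closedBall (s := f x - f y - L * r)
    (fun w hw => by linarith [(abs_le.1 (hball' w hw)).1]) hp (hball v)
  have h3 := le_doob_of_le_on hP hc hpos hc₀ hb m (g := fun _ => 1) continuous_const
    (fun _ => zero_le_one) measurableSet_closedBall (s := 1) (fun _ _ => le_rfl) hp (hball u)
  rw [doob_const_sub hP hc hpos heig m hf] at h1
  rw [doob_sub_const hP hc hpos heig m hf] at h2
  rw [doob_const hP hc hpos heig] at h3
  set q := p * c₀ / c₁
  have h4 : (1 - q) * (f z - f y) ≤ (1 - q) * a :=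
    mul_le_mul_of_nonneg_left (ha z y) (by linarith)
  linarith

theorem doob_contraction [Nonempty X] (hP : GenKernel P) (hi : CondI P) {A : Set X}
    (hA : A.Nonempty) (hii : CondII P A) (hiv : CondIV P 1)
    (hlip : IsLip h) (hpos : ∀ u, 0 < h u) (heig : ∀ u, PP P 1 h u = h u) :
    ∃ m : ℕ, 1 ≤ m ∧ ∃ β q : ℝ, 0 < β ∧ 0 < q ∧ q < 1 ∧ ∀ (f : X → ℝ) (a L : ℝ), 0 ≤ L →
      (∀ u v, f u - f v ≤ a) → (∀ u v, |f u - f v| ≤ L * dist u v) →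
      ∃ a' L' : ℝ, 0 ≤ L' ∧ (∀ u v, doob P h m f u - doob P h m f v ≤ a') ∧
        (∀ u v, |doob P h m f u - doob P h m f v| ≤ L' * dist u v) ∧
        a' + β * L' ≤ q * (a + β * L) := by
  obtain ⟨x, hx⟩ := hA
  have hc := hlip.continuous
  obtain ⟨c₀, c₁, hc₀, hc₁, hb⟩ := exists_pos_bounds hc hpos
  obtain ⟨C, hC, hlipC⟩ := doob_lipschitz_le hP hi hiv hlip hpos heig
  obtain ⟨m, hm, p, hp, hball⟩ := hii (1 / (16 * C)) (by positivity)
  have hq0 : 0 < p * c₀ / c₁ := by positivity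
  refine ⟨m, hm, p * c₀ / c₁ / (2 * C), max (1 - p * c₀ / c₁ / 2) (3 / 4), by positivity,
    lt_max_of_lt_right (by norm_num), max_lt (by linarith) (by norm_num), ?_⟩
  intro f a L hL ha hfL
  have ha0 : 0 ≤ a := by simpa using ha x x
  refine ⟨_, _, ?_, doob_oscillation_le hP hc hpos heig hc₀ hb hp (fun u => hball u x hx) hL ha hfL,
    hlipC m hm f a L hL ha hfL, ?_⟩
  · positivity
  set q := p * c₀ / c₁
  have h1 : (1 - q / 2) * a ≤ max (1 - q / 2) (3 / 4) * a :=
    mul_le_mul_of_nonneg_right (le_max_left _ _) ha0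
  have h2 : 3 / 4 * (q / (2 * C) * L) ≤ max (1 - q / 2) (3 / 4) * (q / (2 * C) * L) :=
    mul_le_mul_of_nonneg_right (le_max_right _ _) (by positivity)
  calc (1 - q) * a + 2 * (1 / (16 * C)) * q * L + q / (2 * C) * (C * a + 1 / 2 * L)
      = (1 - q / 2) * a + 3 / 4 * (q / (2 * C) * L) := by field_simp; ring
    _ ≤ _ := by rw [mul_add]; exact add_le_add h1 h2

theorem doob_oscillation_decay [Nonempty X] (hP : GenKernel P) (hi : CondI P) {A : Set X}
    (hA : A.Nonempty) (hii : CondII P A) (hiv : CondIV P 1)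
    (hlip : IsLip h) (hpos : ∀ u, 0 < h u) (heig : ∀ u, PP P 1 h u = h u) :
    ∃ C : ℝ, 0 < C ∧ ∃ γ : ℝ, 0 < γ ∧ ∀ (f : X → ℝ) (a L : ℝ), 0 ≤ L →
      (∀ u v, f u - f v ≤ a) → (∀ u v, |f u - f v| ≤ L * dist u v) →
      ∀ (k : ℕ) (u v : X),
        doob P h k f u - doob P h k f v ≤ C * (a + L) * Real.exp (-γ * k) := by
  have hc := hlip.continuous
  obtain ⟨m, hm, β, q, hβ, hq0, hq1, hcontr⟩ := doob_contraction hP hi hA hii hiv hlip hpos heig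
  have hδ : Real.log q < 0 := Real.log_neg hq0 hq1
  have hm0 : (0 : ℝ) < m := by exact_mod_cast hm
  refine ⟨(1 + β) * Real.exp (-Real.log q), by positivity, -Real.log q / m,
    div_pos (by linarith) hm0, ?_⟩
  intro f a L hL ha hfL k u v
  have hf : Continuous f := IsLip.continuous ⟨L, hfL⟩
  have ha0 : 0 ≤ a := by simpa using ha u u
  have hiter : ∀ n : ℕ, ∃ a' L' : ℝ, 0 ≤ L' ∧
      (∀ u v, doob P h (m * n) f u - doob P h (m * n) f v ≤ a') ∧
      (∀ u v, |doob P h (m * n) f u - doob P h (m * n) f v| ≤ L' * dist u v) ∧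
      a' + β * L' ≤ q ^ n * (a + β * L) := by
    intro n
    induction n with
    | zero => exact ⟨a, L, hL, by simpa [doob_zero hpos] using ha,
        by simpa [doob_zero hpos] using hfL, by simp⟩
    | succ n ih =>
      obtain ⟨a₁, L₁, hL₁, ha₁, hfL₁, h₁⟩ := ih
      obtain ⟨a₂, L₂, hL₂, ha₂, hfL₂, h₂⟩ := hcontr _ a₁ L₁ hL₁ ha₁ hfL₁
      rw [← doob_add hP hc hpos m _ hf] at ha₂ hfL₂
      rw [mul_add, mul_one, add_comm]
      refine ⟨a₂, L₂, hL₂, ha₂, hfL₂, h₂.trans ?_⟩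
      rw [pow_succ', mul_assoc]
      exact mul_le_mul_of_nonneg_left h₁ hq0.le
  obtain ⟨a', L', hL', ha', -, hN⟩ := hiter (k / m)
  have h1 : doob P h k f u - doob P h k f v ≤ a' := by
    rw [← Nat.mod_add_div k m, doob_add hP hc hpos _ _ hf]
    exact doob_sub_le hP hc hpos heig _ (continuous_doob hP hc hpos _ hf) ha' u v
  have hpow : q ^ (k / m) ≤ Real.exp (-Real.log q) * Real.exp (-(-Real.log q / m) * k) := by
    rw [← Real.exp_add, ← Real.rpow_natCast, Real.rpow_def_of_pos hq0, Real.exp_le_exp]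
    have hlt : (k : ℝ) / m ≤ (k / m : ℕ) + 1 := by
      rw [div_le_iff₀ hm0]
      have := Nat.lt_mul_div_succ k hm
      have h' : (k : ℝ) < m * ((k / m : ℕ) + 1) := by exact_mod_cast this
      linarith
    have := mul_le_mul_of_nonpos_left hlt hδ.le
    have he : -(-Real.log q / m) * k = Real.log q * (k / m) := by ring
    rw [he]
    linarith
  have hab : a + β * L ≤ (1 + β) * (a + L) := by nlinarith [mul_nonneg hβ.le ha0]
  have : 0 ≤ β * L' := by positivity
  calc doob P h k f u - doob P h k f v ≤ q ^ (k / m) * (a + β * L) := by linarith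
    _ ≤ Real.exp (-Real.log q) * Real.exp (-(-Real.log q / m) * k) * ((1 + β) * (a + L)) :=
      mul_le_mul hpow hab (by positivity) (by positivity)
    _ = _ := by ring

theorem integral_SStar (hP : GenKernel P) (hc : Continuous h) (hpos : ∀ u, 0 < h u) (k : ℕ)
    (σ : Measure X) [IsFiniteMeasure σ] {f : X → ℝ} (hf : Continuous f) :
    ∫ v, f v ∂(SStar P h k σ) = ∫ v, doob P h k f v ∂σ := by
  have hci : Continuous fun u => (h u)⁻¹ := hc.inv₀ fun u => (hpos u).ne'
  have : IsFiniteMeasure (σ.withDensity fun u => ENNReal.ofReal (h u)⁻¹) :=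
    isFiniteMeasure_withDensity_ofReal (integrable_of_continuous hci σ).2
  have := hP.isFiniteMeasure_bind_iterP k (σ.withDensity fun u => ENNReal.ofReal (h u)⁻¹)
  rw [SStar, integral_withDensity_eq_integral_toReal_smul hc.measurable.ennreal_ofReal (by simp)]
  have e1 : (fun x => (ENNReal.ofReal (h x)).toReal • f x) = fun x => f x * h x := by
    funext x
    rw [ENNReal.toReal_ofReal (hpos x).le, smul_eq_mul, mul_comm]
  rw [e1, integral_bind_eq (hP.measurable_iterP k) (integrable_of_continuous (hf.fun_mul hc) _),
    integral_withDensity_eq_integral_toReal_smul hci.measurable.ennreal_ofReal (by simp)]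
  refine integral_congr_ae (.of_forall fun x => ?_)
  simp only [ENNReal.toReal_ofReal (inv_nonneg.2 (hpos x).le), smul_eq_mul, doob, PP]

theorem integral_doob_of_stationary (hP : GenKernel P) (hc : Continuous h) (hpos : ∀ u, 0 < h u)
    {σ : Measure X} [IsFiniteMeasure σ] (hσ : SStar P h 1 σ = σ) (k : ℕ) {f : X → ℝ}
    (hf : Continuous f) : ∫ v, doob P h k f v ∂σ = ∫ v, f v ∂σ := by
  induction k generalizing f with
  | zero => rw [doob_zero hpos]
  | succ k ih =>
    rw [doob_succ hP hc hpos k hf, ih (continuous_doob hP hc hpos 1 hf),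
      ← integral_SStar hP hc hpos 1 σ hf, hσ]

omit [CompactSpace X] in
theorem SStar_one_withDensity (hc : Continuous h) (hpos : ∀ u, 0 < h u) {μ : Measure X}
    (hstat : PPstar P 1 μ = μ) :
    SStar P h 1 (μ.withDensity fun u => ENNReal.ofReal (h u)) =
      μ.withDensity fun u => ENNReal.ofReal (h u) := by
  have e : (fun u => ENNReal.ofReal (h u)⁻¹) = fun u => (ENNReal.ofReal (h u))⁻¹ :=
    funext fun u => ENNReal.ofReal_inv_of_pos (hpos u)
  rw [SStar, e, withDensity_inv_same hc.measurable.ennreal_ofReal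
    (.of_forall fun u => (ENNReal.ofReal_pos.2 (hpos u)).ne') (by simp)]
  exact congrArg (fun ν : Measure X => ν.withDensity fun u => ENNReal.ofReal (h u)) hstat

end Doob

omit [CompactSpace X] in
theorem eq_of_forall_lipschitz_integral_eq {σ τ : Measure X} [IsProbabilityMeasure σ]
    [IsProbabilityMeasure τ] (H : ∀ f : X → ℝ, IsLip f → ∫ v, f v ∂σ = ∫ v, f v ∂τ) : σ = τ := by
  let σ' : ProbabilityMeasure X := ⟨σ, inferInstance⟩
  let τ' : ProbabilityMeasure X := ⟨τ, inferInstance⟩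
  have : Tendsto (fun _ : ℕ => σ') atTop (nhds τ') := by
    rw [tendsto_iff_forall_lipschitz_integral_tendsto]
    rintro f - ⟨L, hL⟩
    have : ∫ v, f v ∂σ = ∫ v, f v ∂τ :=
      H f ⟨L, fun u v => by simpa [Real.dist_eq] using hL.dist_le_mul u v⟩
    change Tendsto (fun _ : ℕ => ∫ v, f v ∂σ) atTop (nhds (∫ v, f v ∂τ))
    rw [this]
    exact tendsto_const_nhds
  exact congrArg Subtype.val (tendsto_nhds_unique (X := ProbabilityMeasure X) tendsto_const_nhds this)

theorem stmt_7
    {X : Type} [MetricSpace X] [CompactSpace X] [MeasurableSpace X] [BorelSpace X]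
    (P : X → Measure X) (A : Set X) (hA : IsClosed A)
    (hker : GenKernel P) (hPA : ∀ u ∈ A, P u Aᶜ = 0)
    (hi : CondI P) (hii : CondII P A)
    (hiii : CondIII P A) (hiv : CondIV P 1)
    (μ : Measure X) (hμ : IsProbabilityMeasure μ) (hsupp : msupp μ = A)
    (hstat : PPstar P 1 μ = μ)
    (h : X → ℝ) (hpos : ∀ u : X, 0 < h u) (hlip : IsLip h)
    (heig : ∀ u : X, PP P 1 h u = h u) (hnorm : ∫ u, h u ∂μ = 1) :
    SStar P h 1 (μ.withDensity fun u => ENNReal.ofReal (h u)) =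
      μ.withDensity (fun u => ENNReal.ofReal (h u)) ∧
    (∀ σ : Measure X, IsProbabilityMeasure σ → SStar P h 1 σ = σ →
      σ = μ.withDensity fun u => ENNReal.ofReal (h u)) ∧
    ∃ C : ℝ, 0 < C ∧ ∃ gam : ℝ, 0 < gam ∧
      ∀ σ : Measure X, IsProbabilityMeasure σ → ∀ k : ℕ, 1 ≤ k →
        ∀ f : X → ℝ, IsLip f → lipNorm f ≤ 1 →
          |(∫ v, f v ∂(SStar P h k σ)) -
              ∫ v, f v ∂(μ.withDensity fun u => ENNReal.ofReal (h u))| ≤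
            C * Real.exp (-gam * k) := by
  have hne : A.Nonempty := hsupp ▸ msupp_nonempty μ
  have : Nonempty X := hne.to_type
  have hc := hlip.continuous
  obtain ⟨C, hC, γ, hγ, hdecay⟩ := doob_oscillation_decay hker hi hne hii hiv hlip hpos heig
  have hst := SStar_one_withDensity hc hpos hstat
  have hprob : IsProbabilityMeasure (μ.withDensity fun u => ENNReal.ofReal (h u)) := by
    constructor
    rw [withDensity_apply _ MeasurableSet.univ, Measure.restrict_univ,
      ← ofReal_integral_eq_lintegral_ofReal (integrable_of_continuous hc μ)
        (.of_forall fun u => (hpos u).le), hnorm, ENNReal.ofReal_one]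
  set τ := μ.withDensity fun u => ENNReal.ofReal (h u)
  have hmain : ∀ (σ : Measure X) [IsProbabilityMeasure σ] (f : X → ℝ) (a L : ℝ), 0 ≤ L →
      (∀ u v, f u - f v ≤ a) → (∀ u v, |f u - f v| ≤ L * dist u v) → ∀ k : ℕ,
      |∫ v, doob P h k f v ∂σ - ∫ v, f v ∂τ| ≤ C * (a + L) * Real.exp (-γ * k) := by
    intro σ _ f a L hL ha hfL k
    have hf : Continuous f := IsLip.continuous ⟨L, hfL⟩
    rw [← integral_doob_of_stationary hker hc hpos hst k hf]
    exact abs_integral_sub_integral_le (continuous_doob hker hc hpos k hf)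
      (hdecay f a L hL ha hfL k) σ τ
  refine ⟨hst, fun σ hσ hσst => ?_, C * (2 + 2), by positivity, γ, hγ, ?_⟩
  · refine eq_of_forall_lipschitz_integral_eq fun f hf => ?_
    have hfc := hf.continuous
    obtain ⟨L, hL⟩ := hf
    have hb := hmain σ f (supX f + supX f) (max L 0) (le_max_right _ _)
      (fun u v => by
        linarith [(abs_le.1 (abs_le_supX hfc u)).2, (abs_le.1 (abs_le_supX hfc v)).1])
      (fun u v => (hL u v).trans (mul_le_mul_of_nonneg_right (le_max_left _ _) dist_nonneg))
    simp only [integral_doob_of_stationary hker hc hpos hσst _ hfc] at hb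
    have hlim : Tendsto (fun k : ℕ => C * (supX f + supX f + max L 0) * Real.exp (-γ * k))
        atTop (nhds (C * (supX f + supX f + max L 0) * 0)) := by
      refine Tendsto.const_mul _ (Real.tendsto_exp_atBot.comp ?_)
      exact tendsto_natCast_atTop_atTop.const_mul_atTop_of_neg (by linarith)
    rw [mul_zero] at hlim
    exact sub_eq_zero.1 (abs_nonpos_iff.1 (ge_of_tendsto' hlim hb))
  · intro σ hσ k _ f hf hf1
    obtain ⟨h1, h2⟩ := bounds_of_lipNorm_le_one hf hf1
    rw [integral_SStar hker hc hpos k σ hf.continuous]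
    exact hmain σ f 2 2 zero_le_two h1 h2 k

end GMK
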